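/- Let v ∈ ℝ with |v| ≠ 1/2 and let K_v(x) = ∫_0^∞ e^{−x·cosh t}·cosh(vt) dt for x > 0. Then for every x > 0, −√(x² + x + max(|v|, 1/2)²) < x·K_v′(x)/K_v(x) < −√(x² + x + min(|v|, 1/2)²). -/

import Mathlib

open Real Filter Set MeasureTheory Topology

/-- The `n`-th moment integral `∫₀^∞ (cosh t)ⁿ e^{-x cosh t} cosh (v t) dt`; up to the sign `(-1)ⁿ`
this is the `n`-th derivative of the modified Bessel function `K_v`. -/
noncomputable def besselMoment (v : ℝ) (n : ℕ) (x : ℝ) : ℝ :=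
  ∫ t in Ioi (0 : ℝ), Real.cosh t ^ n * (Real.exp (-x * Real.cosh t) * Real.cosh (v * t))

lemma cosh_le_exp_of_nonneg {t : ℝ} (ht : 0 ≤ t) : Real.cosh t ≤ Real.exp t := by
  rw [Real.cosh_eq]
  have : Real.exp (-t) ≤ Real.exp t := Real.exp_le_exp.2 (by linarith)
  linarith

lemma cosh_mul_le_exp (v : ℝ) {t : ℝ} (ht : 0 ≤ t) :
    Real.cosh (v * t) ≤ Real.exp (|v| * t) := by
  rw [← Real.cosh_abs, abs_mul, abs_of_nonneg ht]
  exact cosh_le_exp_of_nonneg (by positivity)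

lemma sq_div_four_le_cosh {t : ℝ} (ht : 0 ≤ t) : t ^ 2 / 4 ≤ Real.cosh t := by
  rw [Real.cosh_eq]
  have := Real.quadratic_le_exp_of_nonneg ht
  have := Real.exp_pos (-t)
  linarith

lemma cosh_pow_mul_exp_mul_cosh_le (v : ℝ) (n : ℕ) {x t : ℝ} (hx : 0 < x) (ht : 0 ≤ t) :
    Real.cosh t ^ n * (Real.exp (-x * Real.cosh t) * Real.cosh (v * t)) ≤
      Real.exp ((n + |v| + 1) ^ 2 / x) * Real.exp (-t) := by
  have h1 : Real.cosh t ^ n ≤ Real.exp (n * t) := by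
    rw [Real.exp_nat_mul]
    exact pow_le_pow_left₀ (Real.cosh_pos t).le (cosh_le_exp_of_nonneg ht) n
  have h2 : Real.exp (-x * Real.cosh t) ≤ Real.exp (-x * (t ^ 2 / 4)) := by
    apply Real.exp_le_exp.2
    nlinarith [sq_div_four_le_cosh ht]
  calc Real.cosh t ^ n * (Real.exp (-x * Real.cosh t) * Real.cosh (v * t))
      ≤ Real.exp (n * t) * (Real.exp (-x * (t ^ 2 / 4)) * Real.exp (|v| * t)) := by
        have := cosh_mul_le_exp v ht
        have := Real.cosh_pos (v * t)
        gcongr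
    _ ≤ Real.exp ((n + |v| + 1) ^ 2 / x) * Real.exp (-t) := by
        rw [← Real.exp_add, ← Real.exp_add, ← Real.exp_add]
        apply Real.exp_le_exp.2
        have h3 : (n + |v| + 1) ^ 2 / x - (n + |v| + 1) * t + x * (t ^ 2 / 4) =
            (n + |v| + 1 - x * t / 2) ^ 2 / x := by
          field_simp
          ring
        have h4 : 0 ≤ (n + |v| + 1 - x * t / 2) ^ 2 / x := by positivity
        linarith

lemma continuous_besselMoment_integrand (v : ℝ) (n : ℕ) (x : ℝ) :
    Continuous fun t : ℝ ↦
      Real.cosh t ^ n * (Real.exp (-x * Real.cosh t) * Real.cosh (v * t)) := by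
  have := Real.continuous_cosh
  fun_prop

lemma integrableOn_besselMoment (v : ℝ) (n : ℕ) {x : ℝ} (hx : 0 < x) :
    IntegrableOn (fun t : ℝ ↦
      Real.cosh t ^ n * (Real.exp (-x * Real.cosh t) * Real.cosh (v * t))) (Ioi 0) := by
  refine Integrable.mono' ((integrableOn_exp_neg_Ioi 0).const_mul
    (Real.exp ((n + |v| + 1) ^ 2 / x)))
    (continuous_besselMoment_integrand v n x).aestronglyMeasurable ?_
  refine (ae_restrict_iff' measurableSet_Ioi).2 (Eventually.of_forall fun t ht ↦ ?_)
  have := Real.cosh_pos t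
  have := Real.cosh_pos (v * t)
  rw [Real.norm_of_nonneg (by positivity)]
  exact cosh_pow_mul_exp_mul_cosh_le v n hx (le_of_lt ht)

lemma besselMoment_pos (v : ℝ) (n : ℕ) {x : ℝ} (hx : 0 < x) : 0 < besselMoment v n x := by
  have hpos (t : ℝ) :
      0 < Real.cosh t ^ n * (Real.exp (-x * Real.cosh t) * Real.cosh (v * t)) := by
    have := Real.cosh_pos t
    have := Real.cosh_pos (v * t)
    positivity
  rw [besselMoment, setIntegral_pos_iff_support_of_nonneg_ae
    (Eventually.of_forall fun t ↦ (hpos t).le) (integrableOn_besselMoment v n hx)]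
  rw [Function.support_eq_univ fun t ↦ (hpos t).ne']
  simp

lemma hasDerivAt_besselMoment (v : ℝ) (n : ℕ) {x : ℝ} (hx : 0 < x) :
    HasDerivAt (besselMoment v n) (-besselMoment v (n + 1) x) x := by
  rw [besselMoment, ← integral_neg]
  refine (hasDerivAt_integral_of_dominated_loc_of_deriv_le
    (F := fun y t ↦ Real.cosh t ^ n * (Real.exp (-y * Real.cosh t) * Real.cosh (v * t)))
    (F' := fun y t ↦
      -(Real.cosh t ^ (n + 1) * (Real.exp (-y * Real.cosh t) * Real.cosh (v * t))))
    (bound := fun t ↦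
      Real.cosh t ^ (n + 1) * (Real.exp (-(x / 2) * Real.cosh t) * Real.cosh (v * t)))
    (Ioi_mem_nhds (show x / 2 < x by linarith))
    (Eventually.of_forall fun y ↦
      (continuous_besselMoment_integrand v n y).aestronglyMeasurable)
    (integrableOn_besselMoment v n hx)
    (continuous_besselMoment_integrand v (n + 1) x).neg.aestronglyMeasurable
    (Eventually.of_forall fun t y hy ↦ ?_)
    (integrableOn_besselMoment v (n + 1) (half_pos hx))
    (Eventually.of_forall fun t y _ ↦ ?_)).2
  · have h1 := Real.cosh_pos t
    have := Real.cosh_pos (v * t)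
    rw [norm_neg, Real.norm_of_nonneg (by positivity)]
    have : -y * Real.cosh t ≤ -(x / 2) * Real.cosh t := by
      have : x / 2 < y := hy
      nlinarith
    gcongr
  · have h := ((((hasDerivAt_id y).neg.mul_const (Real.cosh t)).exp.mul_const
      (Real.cosh (v * t))).const_mul (Real.cosh t ^ n))
    refine h.congr_deriv ?_
    simp only [Pi.neg_apply, id]
    ring

lemma besselMoment_le_exp (v : ℝ) (n : ℕ) {x : ℝ} (hx : 1 ≤ x) :
    besselMoment v n x ≤ Real.exp (1 - x) * besselMoment v n 1 := by
  rw [besselMoment, besselMoment, ← integral_const_mul]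
  refine integral_mono (integrableOn_besselMoment v n (by linarith))
    ((integrableOn_besselMoment v n one_pos).const_mul _) fun t ↦ ?_
  have := Real.cosh_pos t
  have := Real.cosh_pos (v * t)
  have h : Real.exp (-x * Real.cosh t) ≤ Real.exp (1 - x) * Real.exp (-1 * Real.cosh t) := by
    rw [← Real.exp_add]
    apply Real.exp_le_exp.2
    nlinarith [Real.one_le_cosh t]
  calc _ ≤ Real.cosh t ^ n *
        ((Real.exp (1 - x) * Real.exp (-1 * Real.cosh t)) * Real.cosh (v * t)) := by gcongr
    _ = _ := by ring

lemma tendsto_pow_mul_besselMoment (v : ℝ) (n k : ℕ) :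
    Tendsto (fun x ↦ x ^ k * besselMoment v n x) atTop (𝓝 0) := by
  have h : Tendsto (fun x : ℝ ↦ x ^ k * Real.exp (-x) * (Real.exp 1 * besselMoment v n 1))
      atTop (𝓝 0) := by
    simpa using (Real.tendsto_pow_mul_exp_neg_atTop_nhds_zero k).mul_const
      (Real.exp 1 * besselMoment v n 1)
  refine squeeze_zero' ?_ ?_ h
  · filter_upwards [eventually_gt_atTop 0] with x hx
    have := besselMoment_pos v n hx
    positivity
  · filter_upwards [eventually_ge_atTop 1] with x hx
    have h1 := besselMoment_le_exp v n hx
    rw [sub_eq_add_neg, Real.exp_add] at h1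
    calc x ^ k * besselMoment v n x
        ≤ x ^ k * (Real.exp 1 * Real.exp (-x) * besselMoment v n 1) := by gcongr
      _ = _ := by ring

/-- The modified Bessel differential equation, in terms of moments. -/
lemma besselMoment_ode (v : ℝ) {x : ℝ} (hx : 0 < x) :
    x ^ 2 * besselMoment v 2 x - x * besselMoment v 1 x - (x ^ 2 + v ^ 2) * besselMoment v 0 x
      = 0 := by
  have i0 := (integrableOn_besselMoment v 0 hx).const_mul (x ^ 2 + v ^ 2)
  have i1 := (integrableOn_besselMoment v 1 hx).const_mul x
  have i2 := (integrableOn_besselMoment v 2 hx).const_mul (x ^ 2)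
  have hlim : Tendsto (fun t : ℝ ↦ -x * Real.sinh t * (Real.exp (-x * Real.cosh t) *
      Real.cosh (v * t)) - v * (Real.exp (-x * Real.cosh t) * Real.sinh (v * t)))
      atTop (𝓝 0) := by
    have hb : Tendsto (fun t : ℝ ↦ (x * Real.exp (((1 : ℕ) + |v| + 1) ^ 2 / x) +
        |v| * Real.exp (((0 : ℕ) + |v| + 1) ^ 2 / x)) * Real.exp (-t)) atTop (𝓝 0) := by
      simpa using Real.tendsto_exp_neg_atTop_nhds_zero.const_mul
        (x * Real.exp (((1 : ℕ) + |v| + 1) ^ 2 / x) +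
          |v| * Real.exp (((0 : ℕ) + |v| + 1) ^ 2 / x))
    refine squeeze_zero_norm' ?_ hb
    filter_upwards [eventually_ge_atTop 0] with t ht
    have b0 := cosh_pow_mul_exp_mul_cosh_le v 0 hx ht
    have b1 := cosh_pow_mul_exp_mul_cosh_le v 1 hx ht
    have hs (s : ℝ) : |Real.sinh s| ≤ Real.cosh s := by
      rw [Real.abs_sinh, ← Real.cosh_abs s]
      exact (Real.sinh_lt_cosh _).le
    have := Real.cosh_pos t
    have := Real.cosh_pos (v * t)
    calc _ ≤ |-x * Real.sinh t * (Real.exp (-x * Real.cosh t) * Real.cosh (v * t))| +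
          |v * (Real.exp (-x * Real.cosh t) * Real.sinh (v * t))| := by
          simpa only [Real.norm_eq_abs] using abs_sub _ _
      _ = x * |Real.sinh t| * (Real.exp (-x * Real.cosh t) * Real.cosh (v * t)) +
          |v| * (Real.exp (-x * Real.cosh t) * |Real.sinh (v * t)|) := by
          simp only [abs_mul, abs_neg, Real.abs_exp, abs_of_pos hx,
            abs_of_pos this]
      _ ≤ x * Real.cosh t * (Real.exp (-x * Real.cosh t) * Real.cosh (v * t)) +
          |v| * (Real.exp (-x * Real.cosh t) * Real.cosh (v * t)) := by
          gcongr <;> exact hs _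
      _ = x * (Real.cosh t ^ 1 * (Real.exp (-x * Real.cosh t) * Real.cosh (v * t))) +
          |v| * (Real.cosh t ^ 0 * (Real.exp (-x * Real.cosh t) * Real.cosh (v * t))) := by
          ring
      _ ≤ x * (Real.exp (((1 : ℕ) + |v| + 1) ^ 2 / x) * Real.exp (-t)) +
          |v| * (Real.exp (((0 : ℕ) + |v| + 1) ^ 2 / x) * Real.exp (-t)) := by
          gcongr
      _ = _ := by ring
  have key := integral_Ioi_of_hasDerivAt_of_tendsto' (a := (0 : ℝ)) (m := 0)
    (f := fun t : ℝ ↦ -x * Real.sinh t * (Real.exp (-x * Real.cosh t) *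
      Real.cosh (v * t)) - v * (Real.exp (-x * Real.cosh t) * Real.sinh (v * t)))
    (fun t _ ↦ ?_) ((i2.sub i1).sub i0) hlim
  · have e1 := integral_sub (i2.sub i1) i0
    have e2 := integral_sub i2 i1
    simp only [Pi.sub_apply] at key e1 e2
    rw [e1, e2, integral_const_mul, integral_const_mul, integral_const_mul] at key
    simpa [besselMoment] using key
  · have he : HasDerivAt (fun t ↦ Real.exp (-x * Real.cosh t))
        (Real.exp (-x * Real.cosh t) * (-x * Real.sinh t)) t :=
      ((Real.hasDerivAt_cosh t).const_mul (-x)).exp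
    have hv : HasDerivAt (fun t ↦ v * t) v t := by
      simpa using (hasDerivAt_id t).const_mul v
    have h := (((Real.hasDerivAt_sinh t).const_mul (-x)).mul (he.mul hv.cosh)).sub
      ((he.mul hv.sinh).const_mul v)
    refine h.congr_deriv ?_
    simp only [Pi.sub_apply, Pi.mul_apply]
    have := Real.cosh_sq t
    linear_combination (-x ^ 2 * (Real.exp (-x * Real.cosh t) * Real.cosh (v * t))) * this

lemma pos_of_tendsto_zero_of_deriv_neg {f f' : ℝ → ℝ}
    (hd : ∀ x > 0, HasDerivAt f (f' x) x) (hneg : ∀ x > 0, f' x < 0)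
    (hlim : Tendsto f atTop (𝓝 0)) {x : ℝ} (hx : 0 < x) : 0 < f x := by
  have hanti : StrictAntiOn f (Ioi 0) := by
    refine strictAntiOn_of_deriv_neg (convex_Ioi 0)
      (fun y hy ↦ (hd y hy).continuousAt.continuousWithinAt) fun y hy ↦ ?_
    rw [interior_Ioi] at hy
    rw [(hd y hy).deriv]
    exact hneg y hy
  have h1 : f (x + 1) < f x := hanti hx (show 0 < x + 1 by linarith) (by linarith)
  have h2 : 0 ≤ f (x + 1) := by
    refine le_of_tendsto hlim ?_
    filter_upwards [eventually_ge_atTop (x + 1)] with y hy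
    exact hanti.antitoneOn (show 0 < x + 1 by linarith) (show 0 < y by linarith) hy
  linarith

/-- The sign of `x K_v'(x) + (x + 1/2) K_v(x)` is opposite to that of `v² - 1/4`; the real
parameter `s` only serves to treat both signs at once. -/
lemma besselMoment_linear_comb_pos (v s : ℝ) (hs : s * (v ^ 2 - 1 / 4) < 0) {x : ℝ}
    (hx : 0 < x) :
    0 < s * ((x + 1 / 2) * besselMoment v 0 x - x * besselMoment v 1 x) := by
  have hd (y : ℝ) (hy : 0 < y) : HasDerivAt
      (fun y ↦ s * ((√y)⁻¹ * Real.exp (-y) *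
        ((y + 1 / 2) * besselMoment v 0 y - y * besselMoment v 1 y)))
      (s * (v ^ 2 - 1 / 4) * ((√y)⁻¹ * Real.exp (-y) * besselMoment v 0 y / y)) y := by
    have hsq : 0 < √y := Real.sqrt_pos.2 hy
    have h := (((Real.hasDerivAt_sqrt hy.ne').inv hsq.ne').mul (hasDerivAt_neg y).exp).mul
      ((((hasDerivAt_id y).add_const (1 / 2)).mul (hasDerivAt_besselMoment v 0 hy)).sub
        ((hasDerivAt_id y).mul (hasDerivAt_besselMoment v 1 hy)))
    refine (h.const_mul s).congr_deriv ?_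
    simp only [Pi.sub_apply, Pi.mul_apply, Pi.inv_apply, id, zero_add, Nat.reduceAdd]
    have ode := besselMoment_ode v hy
    have hy2 : √y ^ 2 = y := Real.sq_sqrt hy.le
    generalize √y = r at *
    subst hy2
    field_simp
    linear_combination (16 * s) * ode
  have hlim : Tendsto (fun y ↦ s * ((√y)⁻¹ * Real.exp (-y) *
        ((y + 1 / 2) * besselMoment v 0 y - y * besselMoment v 1 y))) atTop (𝓝 0) := by
    have t0 := tendsto_pow_mul_besselMoment v 0 0
    have t1 := tendsto_pow_mul_besselMoment v 0 1
    have t2 := tendsto_pow_mul_besselMoment v 1 1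
    have t3 := (tendsto_inv_atTop_zero.comp Real.tendsto_sqrt_atTop).mul
      Real.tendsto_exp_neg_atTop_nhds_zero
    have := (t3.mul ((t1.add (t0.const_mul (1 / 2))).sub t2)).const_mul s
    simp only [mul_zero, add_zero, sub_zero] at this
    refine this.congr fun y ↦ ?_
    simp only [Function.comp]
    ring
  have h := pos_of_tendsto_zero_of_deriv_neg hd (fun y hy ↦ ?_) hlim hx
  · have hc : 0 < (√x)⁻¹ * Real.exp (-x) := by positivity
    rw [mul_left_comm] at h
    exact pos_of_mul_pos_right h hc.le
  · have := besselMoment_pos v 0 hy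
    exact mul_neg_of_neg_of_pos hs (by positivity)

lemma besselMoment_quadratic_comb_pos (v s : ℝ) (hs : s * (v ^ 2 - 1 / 4) < 0) {x : ℝ}
    (hx : 0 < x) :
    0 < s * (x ^ 2 * besselMoment v 1 x ^ 2 - (x ^ 2 + x + v ^ 2) * besselMoment v 0 x ^ 2) := by
  refine pos_of_tendsto_zero_of_deriv_neg
    (f := fun x ↦ s * (x ^ 2 * besselMoment v 1 x ^ 2 -
      (x ^ 2 + x + v ^ 2) * besselMoment v 0 x ^ 2))
    (f' := fun x ↦ -2 * besselMoment v 0 x *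
      (s * ((x + 1 / 2) * besselMoment v 0 x - x * besselMoment v 1 x)))
    (fun y hy ↦ ?_) (fun y hy ↦ ?_) ?_ hx
  · have h0 := hasDerivAt_besselMoment v 0 hy
    have h1 := hasDerivAt_besselMoment v 1 hy
    have hsq := hasDerivAt_pow 2 y
    have h := ((hsq.mul (h1.pow 2)).sub
      (((hsq.add (hasDerivAt_id y)).add_const (v ^ 2)).mul (h0.pow 2))).const_mul s
    refine h.congr_deriv ?_
    simp only [Pi.add_apply, Pi.pow_apply, id, zero_add, Nat.reduceAdd]
    have ode := besselMoment_ode v hy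
    push_cast
    linear_combination (-2 * s * besselMoment v 1 y) * ode
  · have h1 := besselMoment_linear_comb_pos v s hs hy
    have h0 := besselMoment_pos v 0 hy
    nlinarith [mul_pos h0 h1]
  · have t0 := tendsto_pow_mul_besselMoment v 0 0
    have t1 := tendsto_pow_mul_besselMoment v 0 1
    have t2 := tendsto_pow_mul_besselMoment v 1 1
    have := (((t2.mul t2).sub (((t1.mul t1).add (t1.mul t0)).add
      ((t0.mul t0).const_mul (v ^ 2))))).const_mul s
    simp only [mul_zero, add_zero, sub_zero] at this
    refine this.congr fun y ↦ ?_
    ring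

theorem stmt_19 (v : ℝ) (hv : |v| ≠ 1 / 2)
    (K : ℝ → ℝ)
    (hK : ∀ x, K x = ∫ t in Ioi (0 : ℝ), Real.exp (-x * Real.cosh t) * Real.cosh (v * t)) :
    ∀ x > (0 : ℝ),
      -Real.sqrt (x ^ 2 + x + max |v| (1 / 2) ^ 2) < x * deriv K x / K x ∧
      x * deriv K x / K x < -Real.sqrt (x ^ 2 + x + min |v| (1 / 2) ^ 2) := by
  intro x hx
  obtain rfl : K = besselMoment v 0 := by
    ext y
    simp [hK, besselMoment]
  rw [(hasDerivAt_besselMoment v 0 hx).deriv, mul_neg, neg_div, neg_lt_neg_iff, neg_lt_neg_iff,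
    zero_add]
  have p0 := besselMoment_pos v 0 hx
  have p1 := besselMoment_pos v 1 hx
  have hhalf : √(x ^ 2 + x + (1 / 2) ^ 2) = x + 1 / 2 := by
    rw [show x ^ 2 + x + (1 / 2) ^ 2 = (x + 1 / 2) ^ 2 by ring]
    exact Real.sqrt_sq (by positivity)
  have hq : 0 < x * besselMoment v 1 x / besselMoment v 0 x := by positivity
  rcases lt_or_gt_of_ne hv with h | h
  · have hv2 : v ^ 2 < 1 / 4 := by
      rw [← sq_abs]; nlinarith [abs_nonneg v]
    have hR := besselMoment_linear_comb_pos v 1 (by linarith) hx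
    have hQ := besselMoment_quadratic_comb_pos v 1 (by linarith) hx
    rw [max_eq_right h.le, min_eq_left h.le, hhalf, sq_abs, Real.sqrt_lt' hq, div_pow,
      div_lt_iff₀ p0, lt_div_iff₀ (by positivity)]
    constructor <;> linarith
  · have hv2 : 1 / 4 < v ^ 2 := by
      rw [← sq_abs]; nlinarith [abs_nonneg v]
    have hR := besselMoment_linear_comb_pos v (-1) (by linarith) hx
    have hQ := besselMoment_quadratic_comb_pos v (-1) (by linarith) hx
    rw [max_eq_left h.le, min_eq_right h.le, hhalf, sq_abs, Real.lt_sqrt hq.le, div_pow,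
      lt_div_iff₀ p0, div_lt_iff₀ (by positivity)]
    constructor <;> linarith
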